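/- arXiv:1209.2058 — 6 statements merged into one kernel-verified Lean document; each statement's English description precedes it below -/
import Mathlib

section
/- Lower-bound invariant of distance-vector routing: for every initial estimate d₀ : V → ℕ∞, every vertex i, and every number of rounds k ∈ ℕ, the k-fold iterate satisfies F^[k](d₀)(i) ≥ min(edist_G(i,t), k). -/
open SimpleGraph

/-- The synchronous distance-vector (Bellman–Ford) routing update toward target `t`. -/
noncomputable def routeUpdate {V : Type*} [Fintype V] [DecidableEq V] (G : SimpleGraph V) (t : V)
    (d : V → ℕ∞) : V → ℕ∞ :=
  fun i => if i = t then 0 else 1 + ⨅ j ∈ G.neighborSet i, d j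

theorem stmt_1 {V : Type*} [Fintype V] [DecidableEq V] (G : SimpleGraph V) (t : V)
    (d₀ : V → ℕ∞) (i : V) (k : ℕ) :
    min (G.edist i t) (k : ℕ∞) ≤ (routeUpdate G t)^[k] d₀ i := by
  induction k generalizing i with
  | zero => simp
  | succ k ih =>
    rw [Function.iterate_succ_apply']
    unfold routeUpdate
    split_ifs with h
    · subst h
      simp
    · rw [← tsub_le_iff_left]
      refine le_iInf₂ fun j hj => ?_
      have hadj : G.edist i j = 1 := edist_eq_one_iff_adj.mpr hj
      have htri : G.edist i t ≤ 1 + G.edist j t := hadj ▸ G.edist_triangle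
      refine le_trans ?_ (ih j)
      rw [tsub_le_iff_left]
      rcases le_total (G.edist j t) (k : ℕ∞) with hle | hle
      · rw [min_eq_left hle]
        exact (min_le_left _ _).trans htri
      · rw [min_eq_right hle]
        refine (min_le_right _ _).trans (le_of_eq ?_)
        push_cast
        exact add_comm _ _
end

section
/- Self-stabilization of distance-vector routing (Lemma 'dist'): for every initial estimate d₀ : V → ℕ∞ with d₀(t) = 0, every vertex i connected to t, and every k ∈ ℕ with edist_G(i,t) ≤ k, the k-fold iterate satisfies F^[k](d₀)(i) = edist_G(i,t). In particular, within h = edist_G(i,t) rounds the distance estimate at i stabilizes to the true target distance and remains there forever after. -/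
open SimpleGraph

theorem routeUpdate_lower {V : Type*} [Fintype V] [DecidableEq V] (G : SimpleGraph V) (t : V)
    (d₀ : V → ℕ∞) (k : ℕ) : ∀ i : V,
    min (k : ℕ∞) (G.edist i t) ≤ (routeUpdate G t)^[k] d₀ i := by
  induction k with
  | zero => intro i; simp
  | succ k ih =>
    intro i
    rw [Function.iterate_succ_apply']
    unfold routeUpdate
    split_ifs with h
    · subst h; simp
    · rw [← tsub_le_iff_left]
      refine le_iInf₂ fun j hj => ?_
      refine le_trans ?_ (ih j)
      rw [tsub_le_iff_left]
      have h1 : G.edist i t ≤ 1 + G.edist j t := by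
        refine (G.edist_triangle (v := j)).trans ?_
        rw [SimpleGraph.edist_eq_one_iff_adj.mpr hj]
      rcases le_total (k : ℕ∞) (G.edist j t) with h2 | h2
      · rw [min_eq_left h2]
        refine (min_le_left _ _).trans ?_
        push_cast
        rw [add_comm]
      · rw [min_eq_right h2]
        exact (min_le_right _ _).trans h1

theorem routeUpdate_target {V : Type*} [Fintype V] [DecidableEq V] (G : SimpleGraph V) (t : V)
    (d₀ : V → ℕ∞) (h₀ : d₀ t = 0) (k : ℕ) : (routeUpdate G t)^[k] d₀ t = 0 := by
  cases k with
  | zero => exact h₀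
  | succ k => rw [Function.iterate_succ_apply']; simp [routeUpdate]

theorem routeUpdate_upper {V : Type*} [Fintype V] [DecidableEq V] (G : SimpleGraph V) (t : V)
    (d₀ : V → ℕ∞) (h₀ : d₀ t = 0) (k : ℕ) : ∀ (i : V) (p : G.Walk i t), p.length ≤ k →
    (routeUpdate G t)^[k] d₀ i ≤ p.length := by
  induction k with
  | zero =>
    intro i p hp
    have := SimpleGraph.Walk.eq_of_length_eq_zero (Nat.le_zero.mp hp)
    subst this
    rw [routeUpdate_target G _ d₀ h₀]
    exact zero_le
  | succ k ih =>
    intro i p hp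
    cases p with
    | nil => rw [routeUpdate_target G _ d₀ h₀]; exact zero_le
    | cons h q =>
      rename_i j
      rw [Function.iterate_succ_apply']
      unfold routeUpdate
      split_ifs with h'
      · exact zero_le
      · rw [SimpleGraph.Walk.length_cons] at hp ⊢
        push_cast
        rw [add_comm]
        gcongr
        exact (iInf₂_le j h).trans (ih j q (by omega))

theorem stmt_2 {V : Type*} [Fintype V] [DecidableEq V] (G : SimpleGraph V) (t : V)
    (d₀ : V → ℕ∞) (h₀ : d₀ t = 0) (i : V) (hconn : G.Reachable i t)
    (k : ℕ) (hk : G.edist i t ≤ (k : ℕ∞)) :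
    (routeUpdate G t)^[k] d₀ i = G.edist i t := by
  apply le_antisymm
  · obtain ⟨p, hp⟩ := hconn.exists_walk_length_eq_edist
    rw [← hp] at hk ⊢
    exact routeUpdate_upper G t d₀ h₀ k i p (by exact_mod_cast hk)
  · have := routeUpdate_lower G t d₀ k i
    rwa [min_eq_right hk] at this
end

section
/- Divergence of distance estimates at disconnected vertices: for every initial estimate d₀ : V → ℕ∞, every vertex i with edist_G(i,t) = ∞ (i.e., i is not connected to the target t), and every k ∈ ℕ, the k-fold iterate satisfies F^[k](d₀)(i) ≥ k; hence the distance estimate at a target-disconnected vertex grows without bound. -/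
open SimpleGraph

theorem stmt_3 {V : Type*} [Fintype V] [DecidableEq V] (G : SimpleGraph V) (t : V)
    (d₀ : V → ℕ∞) (i : V) (hi : G.edist i t = ⊤) (k : ℕ) :
    (k : ℕ∞) ≤ (routeUpdate G t)^[k] d₀ i := by
  induction k generalizing i with
  | zero => simp
  | succ k ih =>
    have hit : i ≠ t := by
      rintro rfl
      simp at hi
    rw [Function.iterate_succ_apply']
    simp only [routeUpdate, if_neg hit]
    push_cast
    rw [add_comm]
    gcongr
    refine le_iInf₂ fun j hj => ih j ?_
    by_contra h
    have h1 : G.Reachable j t := SimpleGraph.edist_ne_top_iff_reachable.mp h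
    have h2 : G.Adj i j := hj
    exact SimpleGraph.edist_ne_top_iff_reachable.mpr (h2.reachable.trans h1) hi
end

section
/- Uniqueness of the stabilized routing table on the target's component: if d : V → ℕ∞ is any fixed point of F (i.e., F(d) = d), then d(i) = edist_G(i,t) for every vertex i connected to t. -/
open SimpleGraph

theorem stmt_5 {V : Type*} [Fintype V] [DecidableEq V] (G : SimpleGraph V) (t : V)
    (d : V → ℕ∞) (hfix : routeUpdate G t d = d) :
    ∀ i : V, G.Reachable i t → d i = G.edist i t := by
  have ht : d t = 0 := by
    rw [← hfix]; simp [routeUpdate]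
  have hs : ∀ i, i ≠ t → d i = 1 + ⨅ j ∈ G.neighborSet i, d j := by
    intro i hi
    conv_lhs => rw [← hfix]
    simp [routeUpdate, hi]
  have upper : ∀ {i s : V} (p : G.Walk i s), s = t → d i ≤ p.length := by
    intro i s p
    induction p with
    | nil => rintro rfl; simp [ht]
    | @cons u v w h p ih =>
      intro hw
      by_cases hu : u = t
      · subst hu; simp [ht]
      · rw [hs u hu, Walk.length_cons, Nat.cast_add, Nat.cast_one, add_comm]
        gcongr
        exact (iInf₂_le v h).trans (ih hw)
  have lower : ∀ n : ℕ, ∀ i, d i ≤ n → G.edist i t ≤ n := by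
    intro n
    induction n with
    | zero =>
      intro i hi
      by_cases h : i = t
      · subst h; simp
      · rw [hs i h] at hi
        simp at hi
    | succ n ih =>
      intro i hi
      by_cases h : i = t
      · subst h; simp
      · rw [hs i h, Nat.cast_add, Nat.cast_one, add_comm] at hi
        have h1 : (⨅ j ∈ G.neighborSet i, d j) ≤ (n : ℕ∞) :=
          (ENat.add_le_add_iff_right ENat.one_ne_top).1 hi
        have h2 : (⨅ j ∈ G.neighborSet i, d j) < (n : ℕ∞) + 1 :=
          lt_of_le_of_lt h1 (by exact_mod_cast Nat.lt_succ_self n)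
        simp only [iInf_lt_iff] at h2
        obtain ⟨j, hj, hlt⟩ := h2
        have h3 := ih j (Order.le_of_lt_add_one hlt)
        have h4 : G.edist i j = 1 := edist_eq_one_iff_adj.2 hj
        calc G.edist i t ≤ G.edist i j + G.edist j t := SimpleGraph.edist_triangle
          _ ≤ 1 + n := by rw [h4]; gcongr
          _ = ((n + 1 : ℕ) : ℕ∞) := by push_cast; rw [add_comm]
  intro i hi
  obtain ⟨p, hp⟩ := hi.exists_walk_length_eq_edist
  have hle := upper p rfl
  apply le_antisymm
  · rw [← hp]; exact hle
  · obtain ⟨n, hn⟩ := ENat.ne_top_iff_exists.1 (ne_top_of_le_ne_top (ENat.coe_ne_top _) hle)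
    rw [← hn]
    exact lower n i hn.ge
end

section
/- Progress under infinitely-often scheduling (abstraction of Lemma 'signal' and Theorem 'progress'): suppose next : V → V satisfies, for every vertex i ≠ t with edist_G(i,t) < ∞, that next(i) is adjacent to i in G and edist_G(next(i),t) + 1 = edist_G(i,t). Let (x_k)_{k∈ℕ} be a sequence in V such that x₀ is connected to t, for every k either x_{k+1} = x_k, or x_k ≠ t and x_{k+1} = next(x_k), and such that for every k with x_k ≠ t there exists k' ≥ k with x_{k'} ≠ t and x_{k'+1} = next(x_{k'}). Then there exists k with x_k = t. -/
open SimpleGraph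

theorem stmt_8 {V : Type*} [Fintype V] (G : SimpleGraph V) (t : V)
    (next : V → V)
    (hnext : ∀ i : V, i ≠ t → G.edist i t < ⊤ →
      G.Adj i (next i) ∧ G.edist (next i) t + 1 = G.edist i t)
    (x : ℕ → V) (h₀ : G.Reachable (x 0) t)
    (hstep : ∀ k : ℕ, x (k + 1) = x k ∨ (x k ≠ t ∧ x (k + 1) = next (x k)))
    (hfair : ∀ k : ℕ, x k ≠ t → ∃ k' ≥ k, x k' ≠ t ∧ x (k' + 1) = next (x k')) :
    ∃ k : ℕ, x k = t := by
  by_contra! hne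
  have hle : ∀ k, G.edist (x k) t < ⊤ ∧ G.edist (x (k + 1)) t ≤ G.edist (x k) t := by
    have key : ∀ k, G.edist (x k) t < ⊤ → G.edist (x (k + 1)) t ≤ G.edist (x k) t := by
      intro k hk
      rcases hstep k with h | ⟨_, h⟩
      · rw [h]
      · rw [h, ← (hnext _ (hne k) hk).2]
        exact le_self_add
    intro k
    induction k with
    | zero =>
      have h : G.edist (x 0) t < ⊤ := lt_top_iff_ne_top.2 (edist_ne_top_iff_reachable.2 h₀)
      exact ⟨h, key 0 h⟩
    | succ k ih =>
      have h := lt_of_le_of_lt ih.2 ih.1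
      exact ⟨h, key _ h⟩
  have hanti : Antitone (fun k => G.edist (x k) t) := antitone_nat_of_succ_le fun k => (hle k).2
  have main : ∀ n : ℕ, ∀ k, ¬ G.edist (x k) t ≤ (n : ℕ∞) := by
    intro n
    induction n with
    | zero =>
      intro k hk
      have h0 : G.edist (x k) t = 0 := by simpa using hk
      exact hne k (edist_eq_zero_iff.1 h0)
    | succ n ih =>
      intro k hk
      obtain ⟨k', hk', _, h⟩ := hfair k (hne k)
      have h1 : G.edist (x k') t ≤ G.edist (x k) t := hanti hk'
      have h2 := (hnext _ (hne k') (hle k').1).2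
      rw [← h] at h2
      apply ih (k' + 1)
      have h3 := h1.trans hk
      rw [← h2] at h3
      push_cast at h3
      exact (ENat.add_le_add_iff_right ENat.one_ne_top).1 h3
  obtain ⟨n, hn⟩ := ENat.ne_top_iff_exists.1 (hle 0).1.ne
  exact main n 0 hn.ge
end

section
/- Gossip (flooding) stabilization (abstraction of Corollaries 'pathGlobal' and 'pintGlobal'): let A be a type, s₀ : V → Set A an initial assignment of sets to vertices, and define s_{k+1}(i) = s_k(i) ∪ ⋃_{j adjacent to i in G} s_k(j). Then for every k ∈ ℕ and every vertex i, s_k(i) = ⋃ { s₀(j) : j ∈ V, edist_G(i,j) ≤ k }. Consequently, if k is at least the diameter of a connected graph G, then s_k(i) = ⋃_{j ∈ V} s₀(j) for every vertex i. -/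
open SimpleGraph

theorem stmt_9 {V : Type*} [Fintype V] {A : Type*} (G : SimpleGraph V)
    (s : ℕ → V → Set A)
    (hstep : ∀ (k : ℕ) (i : V),
      s (k + 1) i = s k i ∪ ⋃ j ∈ G.neighborSet i, s k j) :
    (∀ (k : ℕ) (i : V), s k i = ⋃ j ∈ {j : V | G.edist i j ≤ (k : ℕ∞)}, s 0 j) ∧
    (G.Connected → ∀ k : ℕ, (∀ i j : V, G.edist i j ≤ (k : ℕ∞)) →
      ∀ i : V, s k i = ⋃ j : V, s 0 j) := by
  have main : ∀ (k : ℕ) (i : V),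
      s k i = ⋃ j ∈ {j : V | G.edist i j ≤ (k : ℕ∞)}, s 0 j := by
    intro k
    induction k with
    | zero => intro i; simp
    | succ k ih =>
      intro i
      rw [hstep]
      ext a
      simp only [ih, Set.mem_union, Set.mem_iUnion, Set.mem_setOf_eq, mem_neighborSet,
        exists_prop]
      constructor
      · rintro (⟨j, hj, ha⟩ | ⟨l, hl, j, hj, ha⟩)
        · exact ⟨j, hj.trans (by exact_mod_cast Nat.le_succ k), ha⟩
        · refine ⟨j, ?_, ha⟩
          calc G.edist i j ≤ G.edist i l + G.edist l j := G.edist_triangle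
            _ ≤ 1 + (k : ℕ∞) := add_le_add (edist_eq_one_iff_adj.mpr hl).le hj
            _ = ((k + 1 : ℕ) : ℕ∞) := by push_cast; exact add_comm _ _
      · rintro ⟨j, hj, ha⟩
        obtain ⟨p, hp⟩ := exists_walk_of_edist_ne_top
          (ne_top_of_le_ne_top (ENat.natCast_ne_top _) hj)
        rw [← hp] at hj
        have hj' : p.length ≤ k + 1 := by exact_mod_cast hj
        cases p with
        | nil => exact Or.inl ⟨i, by simp, ha⟩
        | cons h q =>
          rw [Walk.length_cons] at hj'
          refine Or.inr ⟨_, h, j, q.edist_le.trans ?_, ha⟩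
          exact_mod_cast Nat.le_of_succ_le_succ hj'
  refine ⟨main, fun _ k hk i => ?_⟩
  rw [main k i]
  simp [hk]
end
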